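/- There exists a (necessarily unique) homomorphism of Lie algebras over ℝ, φ : sp_{2∞} → End_ℝ(V), such that φ(d_{m,n}) = D_{m,n} for all m, n ∈ ℤ ∖ {0} with m ≥ n. (Here both sp_{2∞} and End_ℝ(V) are Lie algebras under the commutator bracket.) -/

import Mathlib

/-!
Statement 6: there exists a (necessarily unique) homomorphism of Lie algebras over ℝ,
`φ : sp_{2∞} → End_ℝ(V)`, with `φ(d_{m,n}) = D_{m,n}` for all `m ≥ n`.
Since `sp_{2∞}` is a subset of `End_ℝ(F)`, we formalize `φ` as a function on `End_ℝ(F)`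
which is ℝ-linear and bracket-preserving on `sp_{2∞}`, together with the uniqueness of
its restriction to `sp_{2∞}`.
-/

noncomputable section

/-- The free ℝ-module with basis indexed by the nonzero integers. -/
abbrev FreeMod : Type := {k : ℤ // k ≠ 0} →₀ ℝ

/-- The elementary endomorphism `E_{a,b}`. -/
def Eel (a b : {k : ℤ // k ≠ 0}) : Module.End ℝ FreeMod :=
  (Finsupp.lsingle a).comp (Finsupp.lapply b)

/-- `sign m = 1` if `m > 0` and `-1` if `m < 0` (as a real number). -/
def rsign (m : ℤ) : ℝ := if 0 < m then 1 else -1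

/-- The element `d_{m,n} = E_{m,-n} + sign(m)·sign(n)·E_{n,-m}`. -/
def del (m n : ℤ) (hm : m ≠ 0) (hn : n ≠ 0) : Module.End ℝ FreeMod :=
  Eel ⟨m, hm⟩ ⟨-n, neg_ne_zero.mpr hn⟩ +
    (rsign m * rsign n) • Eel ⟨n, hn⟩ ⟨-m, neg_ne_zero.mpr hm⟩

/-- The matrix entry `T_{a,b}`: the coefficient of `u_a` in `T(u_b)`. -/
def entry (T : Module.End ℝ FreeMod) (a b : {k : ℤ // k ≠ 0}) : ℝ :=
  T (Finsupp.single b 1) a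

/-- The Lie algebra `sp_{2∞}` of finitely supported endomorphisms with the symplectic
symmetry conditions on their matrix entries. -/
def spInf : Set (Module.End ℝ FreeMod) :=
  {T | {p : {k : ℤ // k ≠ 0} × {k : ℤ // k ≠ 0} | entry T p.1 p.2 ≠ 0}.Finite ∧
    ∀ m n : ℤ, ∀ hm : 0 < m, ∀ hn : 0 < n,
      entry T ⟨m, hm.ne'⟩ ⟨-n, neg_ne_zero.mpr hn.ne'⟩ =
        entry T ⟨n, hn.ne'⟩ ⟨-m, neg_ne_zero.mpr hm.ne'⟩ ∧
      entry T ⟨-m, neg_ne_zero.mpr hm.ne'⟩ ⟨n, hn.ne'⟩ =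
        entry T ⟨-n, neg_ne_zero.mpr hn.ne'⟩ ⟨m, hm.ne'⟩ ∧
      entry T ⟨-m, neg_ne_zero.mpr hm.ne'⟩ ⟨-n, neg_ne_zero.mpr hn.ne'⟩ =
        - entry T ⟨n, hn.ne'⟩ ⟨m, hm.ne'⟩}

/-- `Q_{m,n} = Σ_{i=1}^b q^i_m ∘ q^i_n`. -/
def Qop {V : Type*} [AddCommGroup V] [Module ℝ V]
    (b : ℕ) (q : Fin b → ℤ → Module.End ℝ V) (m n : ℤ) : Module.End ℝ V :=
  ∑ i, q i m * q i n

/-- `D_{m,n} = (sign(n)/√|m·n|)·Q_{m,n} + δ_{m+n,0}·(b/2)·id`. -/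
def Dop {V : Type*} [AddCommGroup V] [Module ℝ V]
    (b : ℕ) (q : Fin b → ℤ → Module.End ℝ V) (m n : ℤ) : Module.End ℝ V :=
  (rsign n / Real.sqrt |((m * n : ℤ) : ℝ)|) • Qop b q m n +
    (if m + n = 0 then (b : ℝ) / 2 else 0) • 1

section Commutator

variable {A : Type*} [Ring A]

lemma commutator_add_left (a b c : A) : ⁅a + b, c⁆ = ⁅a, c⁆ + ⁅b, c⁆ := by
  simp only [Ring.lie_def]; noncomm_ring

lemma commutator_add_right (a b c : A) : ⁅a, b + c⁆ = ⁅a, b⁆ + ⁅a, c⁆ := by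
  simp only [Ring.lie_def]; noncomm_ring

lemma commutator_zero_left (a : A) : ⁅(0 : A), a⁆ = 0 := by
  simp [Ring.lie_def]

lemma commutator_zero_right (a : A) : ⁅a, (0 : A)⁆ = 0 := by
  simp [Ring.lie_def]

lemma commutator_sum_left {ι : Type*} (s : Finset ι) (f : ι → A) (a : A) :
    ⁅∑ i ∈ s, f i, a⁆ = ∑ i ∈ s, ⁅f i, a⁆ := by
  simp only [Ring.lie_def, Finset.sum_mul, Finset.mul_sum, Finset.sum_sub_distrib]

lemma commutator_sum_right {ι : Type*} (s : Finset ι) (f : ι → A) (a : A) :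
    ⁅a, ∑ i ∈ s, f i⁆ = ∑ i ∈ s, ⁅a, f i⁆ := by
  simp only [Ring.lie_def, Finset.sum_mul, Finset.mul_sum, Finset.sum_sub_distrib]

variable [Algebra ℝ A]

lemma commutator_smul_left (c : ℝ) (a b : A) : ⁅c • a, b⁆ = c • ⁅a, b⁆ := by
  simp only [Ring.lie_def, smul_mul_assoc, mul_smul_comm, smul_sub]

lemma commutator_smul_right (c : ℝ) (a b : A) : ⁅a, c • b⁆ = c • ⁅a, b⁆ := by
  simp only [Ring.lie_def, smul_mul_assoc, mul_smul_comm, smul_sub]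

end Commutator

section Oscillator

variable {ι F V : Type*} [AddCommGroup F] [Module ℝ F] [AddCommGroup V] [Module ℝ V]

/-- The symmetric rank-two endomorphism `z ↦ ω(y, z) x + ω(x, z) y`. -/
def symRankTwo (ω : F →ₗ[ℝ] F →ₗ[ℝ] ℝ) (x y : F) : Module.End ℝ F :=
  (ω y).smulRight x + (ω x).smulRight y

lemma symRankTwo_apply (ω : F →ₗ[ℝ] F →ₗ[ℝ] ℝ) (x y z : F) :
    symRankTwo ω x y z = ω y z • x + ω x z • y := by
  simp [symRankTwo]

/-- The commutator of two symmetric rank-two endomorphisms for a skew-symmetric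
form. -/
lemma lie_symRankTwo (ω : F →ₗ[ℝ] F →ₗ[ℝ] ℝ) (hω : ∀ x y, ω x y = -ω y x) (x y z w : F) :
    ⁅symRankTwo ω x y, symRankTwo ω z w⁆ =
      symRankTwo ω (symRankTwo ω x y z) w + symRankTwo ω z (symRankTwo ω x y w) := by
  ext v
  simp only [Ring.lie_def, LinearMap.sub_apply, LinearMap.add_apply, Module.End.mul_apply,
    symRankTwo_apply, map_add, map_smul, LinearMap.smul_apply, smul_eq_mul]
  rw [hω z x, hω z y, hω w x, hω w y]
  module

/-- The Weyl-ordered quadratic operator `½ ∑ᵢ (Pᵢ x Pᵢ y + Pᵢ y Pᵢ x)`. -/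
def weylQuadratic [Fintype ι] (P : ι → F →ₗ[ℝ] Module.End ℝ V) (x y : F) : Module.End ℝ V :=
  (1 / 2 : ℝ) • ∑ i, (P i x * P i y + P i y * P i x)

lemma weylQuadratic_comm [Fintype ι] (P : ι → F →ₗ[ℝ] Module.End ℝ V) (x y : F) :
    weylQuadratic P x y = weylQuadratic P y x := by
  simp only [weylQuadratic, add_comm]

lemma weylQuadratic_add_left [Fintype ι] (P : ι → F →ₗ[ℝ] Module.End ℝ V) (x x' y : F) :
    weylQuadratic P (x + x') y = weylQuadratic P x y + weylQuadratic P x' y := by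
  simp only [weylQuadratic, ← smul_add, ← Finset.sum_add_distrib, map_add]
  congr 1
  refine Finset.sum_congr rfl fun i _ => ?_
  noncomm_ring

lemma weylQuadratic_smul_left [Fintype ι] (P : ι → F →ₗ[ℝ] Module.End ℝ V) (c : ℝ) (x y : F) :
    weylQuadratic P (c • x) y = c • weylQuadratic P x y := by
  simp only [weylQuadratic, map_smul, smul_mul_assoc, mul_smul_comm, ← smul_add,
    ← Finset.smul_sum, smul_comm c]

lemma lie_weylQuadratic_apply [Fintype ι] [DecidableEq ι] (ω : F →ₗ[ℝ] F →ₗ[ℝ] ℝ)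
    (P : ι → F →ₗ[ℝ] Module.End ℝ V)
    (hP : ∀ i j x y, ⁅P i x, P j y⁆ = (if i = j then ω x y else 0) • 1) (x y z : F) (j : ι) :
    ⁅weylQuadratic P x y, P j z⁆ = P j (symRankTwo ω x y z) := by
  have key (i : ι) : ⁅P i x * P i y + P i y * P i x, P j z⁆ =
      if i = j then (2 : ℝ) • P j (symRankTwo ω x y z) else 0 := by
    have leibniz (a b c : Module.End ℝ V) :
        ⁅a * b + b * a, c⁆ = a * ⁅b, c⁆ + ⁅a, c⁆ * b + (b * ⁅a, c⁆ + ⁅b, c⁆ * a) := by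
      simp only [Ring.lie_def]
      noncomm_ring
    rw [leibniz, hP, hP]
    split_ifs with h
    · subst h
      simp only [symRankTwo_apply, map_add, map_smul, mul_smul_comm, smul_mul_assoc, mul_one,
        one_mul]
      module
    · simp
  rw [weylQuadratic, commutator_smul_left, commutator_sum_left]
  simp [key, smul_smul]

lemma lie_weylQuadratic [Fintype ι] [DecidableEq ι] (ω : F →ₗ[ℝ] F →ₗ[ℝ] ℝ)
    (P : ι → F →ₗ[ℝ] Module.End ℝ V)
    (hP : ∀ i j x y, ⁅P i x, P j y⁆ = (if i = j then ω x y else 0) • 1) (x y z w : F) :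
    ⁅weylQuadratic P x y, weylQuadratic P z w⁆ =
      weylQuadratic P (symRankTwo ω x y z) w + weylQuadratic P z (symRankTwo ω x y w) := by
  have leibniz (c a b : Module.End ℝ V) :
      ⁅c, a * b + b * a⁆ = ⁅c, a⁆ * b + b * ⁅c, a⁆ + (a * ⁅c, b⁆ + ⁅c, b⁆ * a) := by
    simp only [Ring.lie_def]
    noncomm_ring
  rw [weylQuadratic.eq_1 P z w, commutator_smul_right, commutator_sum_right]
  simp only [leibniz, lie_weylQuadratic_apply ω P hP, Finset.sum_add_distrib, smul_add,
    weylQuadratic.eq_1 P _ w, weylQuadratic.eq_1 P z _]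

/-- A linear map sending symmetric rank-two endomorphisms to Weyl-ordered quadratics preserves
commutators. -/
lemma map_lie_of_mem_span_symRankTwo [Fintype ι] [DecidableEq ι] (ω : F →ₗ[ℝ] F →ₗ[ℝ] ℝ)
    (hω : ∀ x y, ω x y = -ω y x) (P : ι → F →ₗ[ℝ] Module.End ℝ V)
    (hP : ∀ i j x y, ⁅P i x, P j y⁆ = (if i = j then ω x y else 0) • 1)
    (φ : Module.End ℝ F →ₗ[ℝ] Module.End ℝ V)
    (hφ : ∀ x y, φ (symRankTwo ω x y) = weylQuadratic P x y) {T T' : Module.End ℝ F}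
    (hT : T ∈ Submodule.span ℝ {S | ∃ x y, S = symRankTwo ω x y})
    (hT' : T' ∈ Submodule.span ℝ {S | ∃ x y, S = symRankTwo ω x y}) :
    φ ⁅T, T'⁆ = ⁅φ T, φ T'⁆ := by
  refine Submodule.span_induction₂ (p := fun S S' _ _ => φ ⁅S, S'⁆ = ⁅φ S, φ S'⁆)
    ?_ ?_ ?_ ?_ ?_ ?_ ?_ hT hT'
  · rintro _ _ ⟨x, y, rfl⟩ ⟨z, w, rfl⟩
    simp only [hφ, lie_symRankTwo ω hω, map_add, lie_weylQuadratic ω P hP]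
  · intro S _
    rw [commutator_zero_left, map_zero, commutator_zero_left]
  · intro S _
    rw [commutator_zero_right, map_zero, commutator_zero_right]
  · intro S S' R _ _ _ h h'
    rw [commutator_add_left, map_add, map_add, commutator_add_left, h, h']
  · intro S R R' _ _ _ h h'
    rw [commutator_add_right, map_add, map_add, commutator_add_right, h, h']
  · intro c S R _ _ h
    rw [commutator_smul_left, map_smul, map_smul, commutator_smul_left, h]
  · intro c S R _ _ h
    rw [commutator_smul_right, map_smul, map_smul, commutator_smul_right, h]

end Oscillator

lemma rsign_mul_self (m : ℤ) : rsign m * rsign m = 1 := by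
  unfold rsign; split_ifs <;> norm_num

lemma rsign_neg {m : ℤ} (hm : m ≠ 0) : rsign (-m) = -rsign m := by
  unfold rsign; split_ifs <;> first | omega | norm_num

lemma rsign_mul_abs (m : ℤ) : rsign m * |(m : ℝ)| = m := by
  unfold rsign
  split_ifs with h
  · rw [abs_of_pos (by exact_mod_cast h), one_mul]
  · rw [abs_of_nonpos (by exact_mod_cast not_lt.mp h)]; ring

/-- Negation on the index set of nonzero integers. -/
def negIndex (k : {k : ℤ // k ≠ 0}) : {k : ℤ // k ≠ 0} := ⟨-k.1, neg_ne_zero.mpr k.2⟩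

lemma negIndex_negIndex (k : {k : ℤ // k ≠ 0}) : negIndex (negIndex k) = k := by
  simp [negIndex]

/-- The symplectic form with `ω(u_k, u_l) = sign(k) δ_{k,-l}`. -/
def symplecticForm : FreeMod →ₗ[ℝ] FreeMod →ₗ[ℝ] ℝ :=
  Finsupp.linearCombination ℝ fun k => rsign k.1 • Finsupp.lapply (negIndex k)

lemma symplecticForm_single (k l : {k : ℤ // k ≠ 0}) (c d : ℝ) :
    symplecticForm (Finsupp.single k c) (Finsupp.single l d) =
      if k.1 + l.1 = 0 then c * d * rsign k.1 else 0 := by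
  have : l = negIndex k ↔ k.1 + l.1 = 0 := by
    rw [Subtype.ext_iff]; simp only [negIndex]; omega
  simp only [symplecticForm, Finsupp.linearCombination_single, LinearMap.smul_apply,
    Finsupp.lapply_apply, Finsupp.single_apply, this, smul_eq_mul]
  split_ifs <;> ring

lemma symplecticForm_skew (x y : FreeMod) : symplecticForm x y = -symplecticForm y x := by
  induction x using Finsupp.induction_linear with
  | zero => simp
  | add x x' h h' => simp only [map_add, LinearMap.add_apply, h, h']; ring
  | single k c =>
    induction y using Finsupp.induction_linear with
    | zero => simp
    | add y y' h h' => simp only [map_add, LinearMap.add_apply, h, h']; ring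
    | single l d =>
      rw [symplecticForm_single, symplecticForm_single, add_comm l.1]
      split_ifs with h
      · rw [show l.1 = -k.1 by omega, rsign_neg k.2]; ring
      · simp

lemma entry_Eel (a b x y : {k : ℤ // k ≠ 0}) :
    entry (Eel a b) x y = if (a, b) = (x, y) then 1 else 0 := by
  simp only [entry, Eel, LinearMap.comp_apply, Finsupp.lapply_apply, Finsupp.lsingle_apply,
    Finsupp.single_apply, Prod.mk.injEq, eq_comm (a := y)]
  split_ifs <;> simp_all

lemma entry_add (S T : Module.End ℝ FreeMod) (x y : {k : ℤ // k ≠ 0}) :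
    entry (S + T) x y = entry S x y + entry T x y := rfl

lemma entry_smul (c : ℝ) (T : Module.End ℝ FreeMod) (x y : {k : ℤ // k ≠ 0}) :
    entry (c • T) x y = c * entry T x y := rfl

lemma entry_sum {α : Type*} (s : Finset α) (T : α → Module.End ℝ FreeMod)
    (x y : {k : ℤ // k ≠ 0}) : entry (∑ i ∈ s, T i) x y = ∑ i ∈ s, entry (T i) x y := by
  simp [entry, LinearMap.sum_apply, Finsupp.finsetSum_apply]

lemma ext_entry {S T : Module.End ℝ FreeMod} (h : ∀ x y, entry S x y = entry T x y) : S = T := by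
  ext y x
  exact h x y

/-- A linear map on `End(F)` may be prescribed arbitrarily on elementary endomorphisms. -/
lemma exists_linearMap_Eel {W : Type*} [AddCommGroup W] [Module ℝ W]
    (w : {k : ℤ // k ≠ 0} → {k : ℤ // k ≠ 0} → W) :
    ∃ φ : Module.End ℝ FreeMod →ₗ[ℝ] W, ∀ a b, φ (Eel a b) = w a b := by
  let f : ({k : ℤ // k ≠ 0} × {k : ℤ // k ≠ 0} →₀ ℝ) →ₗ[ℝ] Module.End ℝ FreeMod :=
    Finsupp.linearCombination ℝ fun p => Eel p.1 p.2
  have hf : LinearMap.ker f = ⊥ := by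
    refine LinearMap.ker_eq_bot'.mpr fun c hc => ?_
    ext ⟨x, y⟩
    have h : entry (f c) x y = 0 := by rw [hc]; rfl
    simpa [f, Finsupp.linearCombination_apply, Finsupp.sum, entry_sum, entry_smul, entry_Eel]
      using h
  obtain ⟨g, hg⟩ := LinearMap.exists_leftInverse_of_injective (K := ℝ)
    (V := {k : ℤ // k ≠ 0} × {k : ℤ // k ≠ 0} →₀ ℝ) (V' := Module.End ℝ FreeMod) f hf
  refine ⟨(Finsupp.linearCombination ℝ fun p => w p.1 p.2) ∘ₗ g, fun a b => ?_⟩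
  have h : g (Eel a b) = Finsupp.single (a, b) 1 := by
    simpa [f] using LinearMap.congr_fun hg (Finsupp.single (a, b) 1)
  simp [h]

lemma symRankTwo_single (m n : {k : ℤ // k ≠ 0}) :
    symRankTwo symplecticForm (Finsupp.single m 1) (Finsupp.single n 1) =
      rsign n.1 • Eel m (negIndex n) + rsign m.1 • Eel n (negIndex m) := by
  have h (m k : {k : ℤ // k ≠ 0}) : m.1 + k.1 = 0 ↔ k = negIndex m := by
    rw [Subtype.ext_iff]; simp only [negIndex]; omega
  refine ext_entry fun x y => ?_
  simp only [entry_add, entry_smul, entry_Eel]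
  simp only [entry, symRankTwo_apply, symplecticForm_single, Finsupp.add_apply,
    Finsupp.smul_apply, Finsupp.single_apply, h, smul_eq_mul, Prod.mk.injEq, eq_comm (a := y)]
  split_ifs <;> simp_all

lemma del_eq_smul_symRankTwo (m n : ℤ) (hm : m ≠ 0) (hn : n ≠ 0) :
    del m n hm hn = rsign n • symRankTwo symplecticForm
      (Finsupp.single ⟨m, hm⟩ 1) (Finsupp.single ⟨n, hn⟩ 1) := by
  rw [symRankTwo_single, smul_add, smul_smul, smul_smul, rsign_mul_self, one_smul, del,
    mul_comm (rsign m)]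
  rfl

lemma del_comm (m n : ℤ) (hm : m ≠ 0) (hn : n ≠ 0) :
    del m n hm hn = (rsign m * rsign n) • del n m hn hm := by
  rw [del_eq_smul_symRankTwo, del_eq_smul_symRankTwo, smul_smul, mul_right_comm, rsign_mul_self,
    one_mul, symRankTwo, symRankTwo, add_comm]

lemma entry_symm_of_mem_spInf {T : Module.End ℝ FreeMod} (hT : T ∈ spInf)
    (x y : {k : ℤ // k ≠ 0}) :
    entry T x y = -(rsign x.1 * rsign y.1) * entry T (negIndex y) (negIndex x) := by
  have hpos {m : ℤ} (h : 0 < m) : rsign m = 1 := if_pos h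
  have hneg {m : ℤ} (h : 0 < m) : rsign (-m) = -1 := by rw [rsign_neg h.ne', hpos h]
  have cases_sign (k : {k : ℤ // k ≠ 0}) : (∃ m, ∃ h : 0 < m, k = ⟨m, ne_of_gt h⟩) ∨
      ∃ m, ∃ h : 0 < m, k = ⟨-m, neg_ne_zero.mpr (ne_of_gt h)⟩ := by
    obtain ⟨k, hk⟩ := k
    rcases lt_or_gt_of_ne hk with h | h
    · exact .inr ⟨-k, by omega, by simp⟩
    · exact .inl ⟨k, h, rfl⟩
  rcases cases_sign x with ⟨m, hm, rfl⟩ | ⟨m, hm, rfl⟩ <;>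
  rcases cases_sign y with ⟨n, hn, rfl⟩ | ⟨n, hn, rfl⟩ <;>
  simp only [negIndex, neg_neg, hpos, hneg, hm, hn]
  · have := (hT.2 n m hn hm).2.2
    linarith
  · have := (hT.2 m n hm hn).1
    linarith
  · have := (hT.2 m n hm hn).2.1
    linarith
  · have := (hT.2 m n hm hn).2.2
    linarith

/-- The elements `d_{m,n}` with `n ≤ m`. -/
def delSet : Set (Module.End ℝ FreeMod) :=
  {T | ∃ m n : ℤ, ∃ hm : m ≠ 0, ∃ hn : n ≠ 0, n ≤ m ∧ T = del m n hm hn}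

lemma del_mem_span (m n : ℤ) (hm : m ≠ 0) (hn : n ≠ 0) :
    del m n hm hn ∈ Submodule.span ℝ delSet := by
  rcases le_total n m with h | h
  · exact Submodule.subset_span ⟨m, n, hm, hn, h, rfl⟩
  · rw [del_comm]
    exact Submodule.smul_mem _ _ (Submodule.subset_span ⟨n, m, hn, hm, h, rfl⟩)

lemma entry_del_negIndex (a b x y : {k : ℤ // k ≠ 0}) :
    entry (del a.1 (negIndex b).1 a.2 (negIndex b).2) x y =
      (if (a, b) = (x, y) then 1 else 0) -
        if (a, b) = (negIndex y, negIndex x) then rsign x.1 * rsign y.1 else 0 := by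
  have h1 : del a.1 (negIndex b).1 a.2 (negIndex b).2 =
      Eel a b - (rsign a.1 * rsign b.1) • Eel (negIndex b) (negIndex a) := by
    simp only [del, negIndex, rsign_neg b.2, neg_neg]
    module
  have h2 : (negIndex b, negIndex a) = (x, y) ↔ (a, b) = (negIndex y, negIndex x) := by
    simp only [Prod.mk.injEq]
    constructor <;> rintro ⟨rfl, rfl⟩ <;> simp [negIndex_negIndex]
  rw [h1, show Eel a b - (rsign a.1 * rsign b.1) • Eel (negIndex b) (negIndex a) =
    Eel a b + (-(rsign a.1 * rsign b.1)) • Eel (negIndex b) (negIndex a) by module, entry_add, entry_smul, entry_Eel, entry_Eel]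
  simp only [h2]
  split_ifs with h3 h4 h4
  all_goals try simp
  all_goals
    simp only [Prod.mk.injEq] at h4
    obtain ⟨rfl, rfl⟩ := h4
    simp only [negIndex, rsign_neg x.2, rsign_neg y.2]
    ring

/-- The set `spInf` as a linear subspace of `End(F)`. -/
def spInfSubmodule : Submodule ℝ (Module.End ℝ FreeMod) where
  carrier := spInf
  zero_mem' := by
    refine ⟨?_, fun m n _ _ => ?_⟩ <;> simp [entry]
  add_mem' := by
    intro S T hS hT
    refine ⟨(hS.1.union hT.1).subset fun p hp => ?_, fun m n hm hn => ?_⟩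
    · by_contra h
      simp only [Set.mem_union, Set.mem_ofPred_eq, not_or, not_not] at h
      exact hp (by rw [entry_add, h.1, h.2, add_zero])
    · obtain ⟨h1, h2, h3⟩ := hS.2 m n hm hn
      obtain ⟨h4, h5, h6⟩ := hT.2 m n hm hn
      simp only [entry_add]
      exact ⟨by rw [h1, h4], by rw [h2, h5], by rw [h3, h6]; ring⟩
  smul_mem' := by
    intro c T hT
    refine ⟨hT.1.subset fun p hp h => hp (by rw [entry_smul, h, mul_zero]),
      fun m n hm hn => ?_⟩
    obtain ⟨h1, h2, h3⟩ := hT.2 m n hm hn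
    simp only [entry_smul]
    exact ⟨by rw [h1], by rw [h2], by rw [h3]; ring⟩

lemma mem_spInf_of_entry_symm {T : Module.End ℝ FreeMod}
    (hfin : {p : {k : ℤ // k ≠ 0} × {k : ℤ // k ≠ 0} | entry T p.1 p.2 ≠ 0}.Finite)
    (hT : ∀ x y, entry T x y =
      -(rsign x.1 * rsign y.1) * entry T (negIndex y) (negIndex x)) : T ∈ spInf := by
  refine ⟨hfin, fun m n hm hn => ?_⟩
  have h1 : rsign m = 1 := if_pos hm
  have h2 : rsign n = 1 := if_pos hn
  refine ⟨?_, ?_, ?_⟩ <;> rw [hT] <;>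
    simp only [negIndex, neg_neg, rsign_neg hm.ne', rsign_neg hn.ne', h1, h2] <;> ring

lemma del_mem_spInf (m n : ℤ) (hm : m ≠ 0) (hn : n ≠ 0) : del m n hm hn ∈ spInf := by
  obtain ⟨b, hb⟩ : ∃ b, negIndex b = ⟨n, hn⟩ := ⟨_, negIndex_negIndex _⟩
  have hentry := entry_del_negIndex ⟨m, hm⟩ b
  simp only [hb] at hentry
  refine mem_spInf_of_entry_symm ?_ fun x y => ?_
  · refine (Set.toFinite {(⟨m, hm⟩, b), (negIndex b, negIndex ⟨m, hm⟩)}).subset ?_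
    rintro ⟨x, y⟩ hxy
    by_contra h
    simp only [Set.mem_insert_iff, Set.mem_singleton_iff, not_or] at h
    refine hxy ?_
    rw [hentry, if_neg (Ne.symm h.1), if_neg, sub_zero]
    intro h'
    obtain ⟨h1, h2⟩ := Prod.mk.inj h'
    exact h.2 (by rw [h1, h2, negIndex_negIndex, negIndex_negIndex])
  · have hx := rsign_mul_self x.1
    have hy := rsign_mul_self y.1
    rw [hentry, hentry, negIndex_negIndex, negIndex_negIndex,
      show rsign (negIndex y).1 = -rsign y.1 from rsign_neg y.2,
      show rsign (negIndex x).1 = -rsign x.1 from rsign_neg x.2]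
    have hxy : rsign x.1 * rsign y.1 * (rsign x.1 * rsign y.1) = 1 := by
      rw [mul_mul_mul_comm, hx, hy, one_mul]
    split_ifs <;> linarith

lemma spInf_subset_span : spInf ⊆ Submodule.span ℝ delSet := by
  intro T hT
  have h : T = (1 / 2 : ℝ) • ∑ p ∈ hT.1.toFinset,
      entry T p.1 p.2 • del p.1.1 (negIndex p.2).1 p.1.2 (negIndex p.2).2 := by
    refine ext_entry fun x y => ?_
    have hmem (a b : {k : ℤ // k ≠ 0}) : (a, b) ∈ hT.1.toFinset ↔ entry T a b ≠ 0 := by simp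
    have key (a b : {k : ℤ // k ≠ 0}) (c : ℝ) :
        ∑ p ∈ hT.1.toFinset, entry T p.1 p.2 * (if p = (a, b) then c else 0) =
          entry T a b * c := by
      simp only [mul_ite, mul_zero, Finset.sum_ite_eq', hmem]
      split_ifs with h0
      · rfl
      · rw [not_not.mp h0, zero_mul]
    simp only [entry_smul, entry_sum, entry_del_negIndex, Prod.mk.eta, mul_sub,
      Finset.sum_sub_distrib, key]
    have := entry_symm_of_mem_spInf hT x y
    linarith
  rw [h]
  exact Submodule.smul_mem _ _ (Submodule.sum_mem _ fun p _ =>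
    Submodule.smul_mem _ _ (del_mem_span _ _ _ _))

section Heisenberg

variable {V : Type*} [AddCommGroup V] [Module ℝ V] {b : ℕ}

/-- The linear extension of `u_k ↦ q_k / √|k|`. -/
def normalizedMode (q : ℤ → Module.End ℝ V) : FreeMod →ₗ[ℝ] Module.End ℝ V :=
  Finsupp.linearCombination ℝ fun k => (√|(k.1 : ℝ)|)⁻¹ • q k.1

lemma lie_normalizedMode (q : Fin b → ℤ → Module.End ℝ V)
    (hq : ∀ i j : Fin b, ∀ n m : ℤ, n ≠ 0 → m ≠ 0 →
      ⁅q i n, q j m⁆ =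
        ((n : ℝ) * (if n + m = 0 then 1 else 0) * (if i = j then 1 else 0)) • 1)
    (i j : Fin b) (x y : FreeMod) :
    ⁅normalizedMode (q i) x, normalizedMode (q j) y⁆ =
      (if i = j then symplecticForm x y else 0) • 1 := by
  induction x using Finsupp.induction_linear with
  | zero => simp [commutator_zero_left]
  | add x x' h h' =>
    simp only [map_add, LinearMap.add_apply, commutator_add_left, h, h', ← add_smul]
    split_ifs <;> simp
  | single k c =>
    induction y using Finsupp.induction_linear with
    | zero => simp [commutator_zero_right]
    | add y y' h h' =>
      simp only [map_add, commutator_add_right, h, h', ← add_smul]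
      split_ifs <;> simp
    | single l d =>
      simp only [normalizedMode, Finsupp.linearCombination_single, symplecticForm_single,
        commutator_smul_left, commutator_smul_right, hq i j _ _ k.2 l.2, smul_smul]
      congr 1
      split_ifs with h1 _ h2
      · have hl : |(l.1 : ℝ)| = |(k.1 : ℝ)| := by
          rw [show l.1 = -k.1 by omega, Int.cast_neg, abs_neg]
        have h0 : |(k.1 : ℝ)| ≠ 0 := abs_ne_zero.mpr (Int.cast_ne_zero.mpr k.2)
        have hinv : (√|(k.1 : ℝ)|)⁻¹ * (√|(k.1 : ℝ)|)⁻¹ * |(k.1 : ℝ)| = 1 := by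
          rw [← mul_inv, Real.mul_self_sqrt (abs_nonneg _), inv_mul_cancel₀ h0]
        rw [hl]
        nth_rewrite 3 [← rsign_mul_abs k.1]
        linear_combination c * d * rsign k.1 * hinv
      all_goals simp

lemma Dop_eq_smul_weylQuadratic (q : Fin b → ℤ → Module.End ℝ V)
    (hq : ∀ i j : Fin b, ∀ n m : ℤ, n ≠ 0 → m ≠ 0 →
      ⁅q i n, q j m⁆ =
        ((n : ℝ) * (if n + m = 0 then 1 else 0) * (if i = j then 1 else 0)) • 1)
    (m n : ℤ) (hm : m ≠ 0) (hn : n ≠ 0) :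
    Dop b q m n = rsign n • weylQuadratic (fun i => normalizedMode (q i))
      (Finsupp.single ⟨m, hm⟩ 1) (Finsupp.single ⟨n, hn⟩ 1) := by
  set x : FreeMod := Finsupp.single ⟨m, hm⟩ 1
  set y : FreeMod := Finsupp.single ⟨n, hn⟩ 1
  have hprod (i : Fin b) : q i m * q i n =
      √|((m * n : ℤ) : ℝ)| • (normalizedMode (q i) x * normalizedMode (q i) y) := by
    have h0 : √|(m : ℝ)| ≠ 0 := by
      rw [Real.sqrt_ne_zero (abs_nonneg _)]; exact abs_ne_zero.mpr (Int.cast_ne_zero.mpr hm)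
    have h1 : √|(n : ℝ)| ≠ 0 := by
      rw [Real.sqrt_ne_zero (abs_nonneg _)]; exact abs_ne_zero.mpr (Int.cast_ne_zero.mpr hn)
    simp only [x, y, normalizedMode, Finsupp.linearCombination_single,
      smul_mul_assoc, mul_smul_comm, smul_smul]
    rw [Int.cast_mul, abs_mul, Real.sqrt_mul (abs_nonneg _)]
    rw [show √|(m : ℝ)| * √|(n : ℝ)| * (1 * (√|(n : ℝ)|)⁻¹ * (1 * (√|(m : ℝ)|)⁻¹)) = 1 by
      field_simp, one_smul]
  have hcomm (i : Fin b) : normalizedMode (q i) y * normalizedMode (q i) x =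
      normalizedMode (q i) x * normalizedMode (q i) y - symplecticForm x y • 1 := by
    have := lie_normalizedMode q hq i i x y
    rw [if_pos rfl, Ring.lie_def] at this
    rw [← this, sub_sub_cancel]
  have hmn : √|((m * n : ℤ) : ℝ)| ≠ 0 := by
    rw [Real.sqrt_ne_zero (abs_nonneg _)]
    exact abs_ne_zero.mpr (Int.cast_ne_zero.mpr (mul_ne_zero hm hn))
  have hform : rsign n * symplecticForm x y = if m + n = 0 then -1 else 0 := by
    rw [symplecticForm_single]
    dsimp only
    split_ifs with h
    · rw [show n = -m by omega, rsign_neg hm]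
      linear_combination -rsign_mul_self m
    · simp
  have hdelta : (if m + n = 0 then (b : ℝ) / 2 else 0) =
      -(rsign n * symplecticForm x y) * (b / 2) := by
    rw [hform]; split_ifs <;> simp
  simp only [Dop, Qop, weylQuadratic, hprod, hcomm, hdelta, ← Finset.smul_sum, smul_smul,
    div_mul_cancel₀ _ hmn, Finset.sum_add_distrib, Finset.sum_sub_distrib, Finset.sum_const,
    Finset.card_univ, Fintype.card_fin, ← Nat.cast_smul_eq_nsmul ℝ]
  module

end Heisenberg

/-- A linear map sending the `ω`-symmetric rank-two endomorphisms to Weyl-ordered quadratics. -/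
lemma exists_linearMap_symRankTwo {V : Type*} [AddCommGroup V] [Module ℝ V] {ι : Type*}
    [Fintype ι] (P : ι → FreeMod →ₗ[ℝ] Module.End ℝ V) :
    ∃ φ : Module.End ℝ FreeMod →ₗ[ℝ] Module.End ℝ V,
      ∀ x y, φ (symRankTwo symplecticForm x y) = weylQuadratic P x y := by
  obtain ⟨φ, hφ⟩ := exists_linearMap_Eel fun a b =>
    (-rsign b.1 / 2) • weylQuadratic P (Finsupp.single a 1) (Finsupp.single (negIndex b) 1)
  have hsymm (x y : FreeMod) :
      symRankTwo symplecticForm x y = symRankTwo symplecticForm y x := add_comm _ _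
  have hadd (x x' y : FreeMod) : symRankTwo symplecticForm (x + x') y =
      symRankTwo symplecticForm x y + symRankTwo symplecticForm x' y := by
    refine LinearMap.ext fun z => ?_
    simp only [symRankTwo_apply, LinearMap.add_apply, map_add]
    module
  have hsmul (c : ℝ) (x y : FreeMod) : symRankTwo symplecticForm (c • x) y =
      c • symRankTwo symplecticForm x y := by
    refine LinearMap.ext fun z => ?_
    simp only [symRankTwo_apply, LinearMap.smul_apply, map_smul, smul_eq_mul]
    module
  have hleft {y : FreeMod} (h : ∀ k, φ (symRankTwo symplecticForm (Finsupp.single k 1) y) =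
      weylQuadratic P (Finsupp.single k 1) y) (x : FreeMod) :
      φ (symRankTwo symplecticForm x y) = weylQuadratic P x y := by
    induction x using Finsupp.induction_linear with
    | zero =>
      rw [← zero_smul ℝ (0 : FreeMod), hsmul, weylQuadratic_smul_left, zero_smul, zero_smul,
        map_zero]
    | add x x' h h' => rw [hadd, weylQuadratic_add_left, map_add, h, h']
    | single k c =>
      rw [← mul_one c, ← smul_eq_mul, ← Finsupp.smul_single, hsmul, weylQuadratic_smul_left,
        map_smul, h]
  refine ⟨φ, fun x y => hleft (fun k => ?_) x⟩
  rw [hsymm, weylQuadratic_comm]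
  refine hleft (fun l => ?_) y
  rw [symRankTwo_single, map_add, map_smul, map_smul, hφ, hφ, negIndex_negIndex,
    negIndex_negIndex, weylQuadratic_comm P (Finsupp.single k 1), smul_smul, smul_smul,
    ← add_smul]
  simp only [negIndex, rsign_neg k.2, rsign_neg l.2]
  rw [show rsign k.1 * (- -rsign k.1 / 2) + rsign l.1 * (- -rsign l.1 / 2) = 1 by
    linear_combination (rsign_mul_self k.1 + rsign_mul_self l.1) / 2, one_smul]

theorem stmt6 {V : Type*} [AddCommGroup V] [Module ℝ V]
    (b : ℕ) (hb : 1 ≤ b) (q : Fin b → ℤ → Module.End ℝ V)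
    (hq : ∀ i j : Fin b, ∀ n m : ℤ, n ≠ 0 → m ≠ 0 →
      ⁅q i n, q j m⁆ =
        ((n : ℝ) * (if n + m = 0 then 1 else 0) * (if i = j then 1 else 0)) • 1) :
    ∃ φ : Module.End ℝ FreeMod → Module.End ℝ V,
      (∀ T ∈ spInf, ∀ T' ∈ spInf, φ (T + T') = φ T + φ T') ∧
      (∀ c : ℝ, ∀ T ∈ spInf, φ (c • T) = c • φ T) ∧
      (∀ T ∈ spInf, ∀ T' ∈ spInf, φ ⁅T, T'⁆ = ⁅φ T, φ T'⁆) ∧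
      (∀ m n : ℤ, ∀ hm : m ≠ 0, ∀ hn : n ≠ 0, n ≤ m → φ (del m n hm hn) = Dop b q m n) ∧
      (∀ ψ : Module.End ℝ FreeMod → Module.End ℝ V,
        (∀ T ∈ spInf, ∀ T' ∈ spInf, ψ (T + T') = ψ T + ψ T') →
        (∀ c : ℝ, ∀ T ∈ spInf, ψ (c • T) = c • ψ T) →
        (∀ m n : ℤ, ∀ hm : m ≠ 0, ∀ hn : n ≠ 0, n ≤ m → ψ (del m n hm hn) = Dop b q m n) →
        ∀ T ∈ spInf, ψ T = φ T) := by
  let P (i : Fin b) := normalizedMode (q i)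
  have hP (i j : Fin b) (x y : FreeMod) :
      ⁅P i x, P j y⁆ = (if i = j then symplecticForm x y else 0) • 1 :=
    lie_normalizedMode q hq i j x y
  obtain ⟨φ, hφ⟩ := exists_linearMap_symRankTwo P
  have hdel (m n : ℤ) (hm : m ≠ 0) (hn : n ≠ 0) : φ (del m n hm hn) = Dop b q m n := by
    rw [del_eq_smul_symRankTwo, map_smul, hφ, Dop_eq_smul_weylQuadratic q hq m n hm hn]
  refine ⟨φ, fun T _ T' _ => map_add φ T T', fun c T _ => map_smul φ c T, ?_,
    fun m n hm hn _ => hdel m n hm hn, ?_⟩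
  · intro T hT T' hT'
    have hspan : Submodule.span ℝ delSet ≤
        Submodule.span ℝ {S | ∃ x y, S = symRankTwo symplecticForm x y} := by
      refine Submodule.span_le.mpr ?_
      rintro _ ⟨m, n, hm, hn, -, rfl⟩
      rw [del_eq_smul_symRankTwo]
      exact Submodule.smul_mem _ _ (Submodule.subset_span ⟨_, _, rfl⟩)
    exact map_lie_of_mem_span_symRankTwo symplecticForm symplecticForm_skew P hP φ hφ
      (hspan (spInf_subset_span hT)) (hspan (spInf_subset_span hT'))
  · intro ψ hadd hsmul hψ T hT
    have hspan : Submodule.span ℝ delSet ≤ spInfSubmodule := by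
      refine Submodule.span_le.mpr ?_
      rintro _ ⟨m, n, hm, hn, -, rfl⟩
      exact del_mem_spInf m n hm hn
    refine Submodule.span_induction (p := fun S _ => ψ S = φ S) ?_ ?_ ?_ ?_
      (spInf_subset_span hT)
    · rintro _ ⟨m, n, hm, hn, hmn, rfl⟩
      rw [hψ m n hm hn hmn, hdel]
    · simpa using hsmul 0 0 spInfSubmodule.zero_mem
    · intro S R hS hR h h'
      rw [hadd S (hspan hS) R (hspan hR), map_add, h, h']
    · intro c S hS h
      rw [hsmul c S (hspan hS), map_smul, h]

end
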